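/- arXiv:1405.2742 — 2 statements merged into one kernel-verified Lean document; each statement's English description precedes it below -/
import Mathlib

section
/- Let (E,𝓔) be a measurable space whose σ-algebra 𝓔 is countably generated, and let T ∈ (0,∞). Let μ_0 be a finite signed measure on (E,𝓔), let λ_0 be a finite (nonnegative) measure on (E,𝓔), and let (ν_t)_{t∈[0,T]} be a family of finite signed measures on (E,𝓔) such that t ↦ ν_t(A) is Borel measurable on [0,T] for every A ∈ 𝓔, ν_t is absolutely continuous with respect to λ_0 for every t ∈ [0,T], and ∫_0^T ‖ν_t‖_TV dt < ∞. Define, for t ∈ [0,T], the finite signed measure μ_t by μ_t(A) = μ_0(A) + ∫_0^t ν_s(A) ds for all A ∈ 𝓔. Then there exists a jointly measurable map σ : [0,T] × E → {−1, 0, 1} such that, for every t ∈ [0,T]: μ_t(A) = ∫_A σ_t d|μ_t| for all A ∈ 𝓔 (i.e. μ_t = σ_t |μ_t|), and |μ_t|(A) = |μ_0|(A) + ∫_0^t (∫_A σ_s dν_s) ds for all A ∈ 𝓔, where |μ| denotes the total variation measure of a signed measure μ. -/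
open MeasureTheory

noncomputable section

/-- Integral `∫_s f dν` of a function over a set against a signed measure,
via the Jordan decomposition. -/
def signedSetIntegral {E : Type*} [MeasurableSpace E] (f : E → ℝ) (s : Set E)
    (ν : SignedMeasure E) : ℝ :=
  (∫ x in s, f x ∂ν.toJordanDecomposition.posPart) -
    ∫ x in s, f x ∂ν.toJordanDecomposition.negPart


open ProbabilityTheory in
lemma aux_posPart_isLUB {E : Type*} [MeasurableSpace E] (𝒜 : Set (Set E))
    (s : SignedMeasure E) (h𝒜 : s.totalVariation.MeasureDense 𝒜) (A : Set E)
    (hA : MeasurableSet A) :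
    IsLUB {a | ∃ B : 𝒜, s (A ∩ (B : Set E)) = a} (s.toJordanDecomposition.posPart.real A) := by
  set P := s.toJordanDecomposition.posPart with hP
  set N := s.toJordanDecomposition.negPart with hN
  constructor
  · rintro a ⟨⟨B, hB⟩, rfl⟩
    have hBm := h𝒜.measurable B hB
    rw [s.apply_eq_posPart_real_sub_negPart_real (hA.inter hBm)]
    have h1 : P.real (A ∩ B) ≤ P.real A := measureReal_mono Set.inter_subset_left
    have h2 : 0 ≤ N.real (A ∩ B) := measureReal_nonneg
    simp only [← hP, ← hN]
    linarith
  · intro u hu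
    refine le_of_forall_pos_le_add fun ε hε => ?_
    obtain ⟨S, hS, hS1, hS2⟩ := s.toJordanDecomposition.mutuallySingular
    rw [← hP] at hS1
    rw [← hN] at hS2
    obtain ⟨t, ht, hlt⟩ := h𝒜.approx Sᶜ hS.compl (measure_ne_top _ _) ε hε
    have htm := h𝒜.measurable t ht
    have hut := hu ⟨⟨t, ht⟩, rfl⟩
    simp only at hut
    rw [s.apply_eq_posPart_real_sub_negPart_real (hA.inter htm), ← hP, ← hN] at hut
    have hPS : P.real S = 0 := by simp [measureReal_def, hS1]
    have hNS : N.real Sᶜ = 0 := by simp [measureReal_def, hS2]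
    have e1 : P.real A ≤ P.real (A ∩ t) + (P.real S + P.real (symmDiff Sᶜ t)) := by
      refine (measureReal_mono (?_ : A ⊆ (A ∩ t) ∪ (S ∪ symmDiff Sᶜ t))).trans
        ((measureReal_union_le _ _).trans ?_)
      · intro x hx
        simp only [Set.mem_union, Set.mem_inter_iff, Set.mem_symmDiff, Set.mem_compl_iff]
        tauto
      · gcongr
        exact measureReal_union_le _ _
    have e2 : N.real (A ∩ t) ≤ N.real Sᶜ + N.real (symmDiff Sᶜ t) := by
      refine (measureReal_mono (?_ : A ∩ t ⊆ Sᶜ ∪ symmDiff Sᶜ t)).trans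
        (measureReal_union_le _ _)
      intro x hx
      simp only [Set.mem_union, Set.mem_inter_iff, Set.mem_symmDiff, Set.mem_compl_iff] at *
      tauto
    have e3 : P.real (symmDiff Sᶜ t) + N.real (symmDiff Sᶜ t) < ε := by
      rw [SignedMeasure.totalVariation, Measure.add_apply, ← hP, ← hN] at hlt
      rw [measureReal_def, measureReal_def, ← ENNReal.toReal_add (measure_ne_top _ _)
        (measure_ne_top _ _)]
      exact (ENNReal.lt_ofReal_iff_toReal_lt (by simp)).1 hlt
    linarith

lemma aux_posPart_measurable {E : Type*} [MeasurableSpace E]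
    [hcg : MeasurableSpace.CountablyGenerated E] (ν : ℝ → SignedMeasure E)
    (hmeas : ∀ A : Set E, MeasurableSet A → Measurable fun t => ν t A)
    (A : Set E) (hA : MeasurableSet A) :
    Measurable fun t => (ν t).toJordanDecomposition.posPart A := by
  obtain ⟨b, hb, hgen⟩ := hcg.isCountablyGenerated
  have hc := countable_generateSetAlgebra hb
  have : Countable (generateSetAlgebra b) := hc.to_subtype
  have hd : ∀ s : SignedMeasure E, s.totalVariation.MeasureDense (generateSetAlgebra b) :=
    fun s => Measure.MeasureDense.of_generateFrom_isSetAlgebra_finite _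
      isSetAlgebra_generateSetAlgebra (by rw [generateFrom_generateSetAlgebra_eq]; exact hgen)
  have h1 : Measurable fun t => (ν t).toJordanDecomposition.posPart.real A := by
    refine Measurable.isLUB (f := fun (B : generateSetAlgebra b) t => ν t (A ∩ (B : Set E)))
      (fun B => hmeas _ (hA.inter ((hd 0).measurable _ B.2))) fun t => ?_
    exact aux_posPart_isLUB _ (ν t) (hd _) A hA
  have h2 : (fun t => (ν t).toJordanDecomposition.posPart A) =
      fun t => ENNReal.ofReal ((ν t).toJordanDecomposition.posPart.real A) := by
    ext t
    rw [measureReal_def, ENNReal.ofReal_toReal (measure_ne_top _ _)]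
  rw [h2]
  exact h1.ennreal_ofReal

open ProbabilityTheory in
lemma aux_kernel_density {E : Type*} [MeasurableSpace E]
    [hcg : MeasurableSpace.CountablyGenerated E] (κ : ℝ → Measure E)
    (hfin : ∀ t, IsFiniteMeasure (κ t))
    (hmeas : ∀ A : Set E, MeasurableSet A → Measurable fun t => κ t A)
    (lam : Measure E) [IsFiniteMeasure lam] :
    ∃ f : ℝ → E → ENNReal, Measurable (Function.uncurry f) ∧
      ∀ t, κ t ≪ lam → κ t = lam.withDensity (f t) := by
  have hc : Measurable fun t => (1 + κ t Set.univ) := (hmeas _ MeasurableSet.univ).const_add 1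
  have hc0 : ∀ t, (1 + κ t Set.univ) ≠ 0 := fun t => by simp
  have hct : ∀ t, (1 + κ t Set.univ) ≠ ⊤ := fun t => by simp
  let k : Kernel ℝ E :=
    { toFun := fun t => (1 + κ t Set.univ)⁻¹ • κ t
      measurable' := by
        refine Measure.measurable_of_measurable_coe _ fun A hA => ?_
        simp only [Measure.smul_apply, smul_eq_mul]
        exact hc.inv.mul (hmeas A hA) }
  have hk : ∀ t, k t = (1 + κ t Set.univ)⁻¹ • κ t := fun t => rfl
  have : IsFiniteKernel k := ⟨⟨1, by simp, fun t => by
    rw [hk, Measure.smul_apply, smul_eq_mul, mul_comm, ← div_eq_mul_inv]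
    exact ENNReal.div_le_of_le_mul (by simp)⟩⟩
  refine ⟨fun t x => (1 + κ t Set.univ) * k.rnDeriv (Kernel.const ℝ lam) t x, ?_, ?_⟩
  · exact (hc.comp measurable_fst).mul (Kernel.measurable_rnDeriv _ _)
  · intro t ht
    have hac : k t ≪ Kernel.const ℝ lam t := by
      rw [hk, Kernel.const_apply]
      exact ht.smul_left _
    have h := (Kernel.singularPart_eq_zero_iff_absolutelyContinuous k (Kernel.const ℝ lam) t).2 hac
    have h2 : k t = lam.withDensity (k.rnDeriv (Kernel.const ℝ lam) t) := by
      conv_lhs => rw [← Kernel.rnDeriv_add_singularPart k (Kernel.const ℝ lam)]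
      rw [add_apply, h, add_zero, Kernel.withDensity_apply _ (Kernel.measurable_rnDeriv _ _),
        Kernel.const_apply]
    change κ t = lam.withDensity ((1 + κ t Set.univ) • k.rnDeriv (Kernel.const ℝ lam) t)
    rw [withDensity_smul _ (Kernel.measurable_rnDeriv_right _ _ _), ← h2, hk, smul_smul,
      ENNReal.mul_inv_cancel (hc0 t) (hct t), one_smul]

lemma aux_signed_density {E : Type*} [MeasurableSpace E]
    [hcg : MeasurableSpace.CountablyGenerated E] (ν : ℝ → SignedMeasure E)
    (hmeas : ∀ A : Set E, MeasurableSet A → Measurable fun t => ν t A)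
    (lam : Measure E) [IsFiniteMeasure lam] :
    ∃ n : ℝ → E → ℝ, Measurable (Function.uncurry n) ∧
      ∀ t, (ν t).totalVariation ≪ lam → Integrable (n t) lam ∧ ν t = lam.withDensityᵥ (n t) := by
  obtain ⟨f, hf, hf'⟩ := aux_kernel_density (fun t => (ν t).toJordanDecomposition.posPart)
    (fun t => inferInstance) (aux_posPart_measurable ν hmeas) lam
  obtain ⟨g, hg, hg'⟩ := aux_kernel_density (fun t => (-ν t).toJordanDecomposition.posPart)
    (fun t => inferInstance) (aux_posPart_measurable (fun t => -ν t) (fun A hA => by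
      exact (hmeas A hA).neg)) lam
  refine ⟨fun t x => (f t x).toReal - (g t x).toReal, hf.ennreal_toReal.sub hg.ennreal_toReal, ?_⟩
  intro t ht
  rw [SignedMeasure.totalVariation_absolutelyContinuous_iff] at ht
  have h1 := hf' t ht.1
  have h2 := hg' t (by simpa [SignedMeasure.toJordanDecomposition_neg] using ht.2)
  simp only [SignedMeasure.toJordanDecomposition_neg, JordanDecomposition.neg_posPart] at h1 h2
  have mf : Measurable (f t) := hf.of_uncurry_left
  have mg : Measurable (g t) := hg.of_uncurry_left
  have if1 : ∫⁻ x, f t x ∂lam ≠ ⊤ := by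
    rw [← setLIntegral_univ, ← withDensity_apply _ MeasurableSet.univ, ← h1]
    exact measure_ne_top _ _
  have ig1 : ∫⁻ x, g t x ∂lam ≠ ⊤ := by
    rw [← setLIntegral_univ, ← withDensity_apply _ MeasurableSet.univ, ← h2]
    exact measure_ne_top _ _
  have i1 := integrable_toReal_of_lintegral_ne_top mf.aemeasurable if1
  have i2 := integrable_toReal_of_lintegral_ne_top mg.aemeasurable ig1
  refine ⟨i1.sub i2, ?_⟩
  ext A hA
  have hwd : lam.withDensityᵥ (fun x => (f t x).toReal - (g t x).toReal) A =
      ∫ x in A, ((f t x).toReal - (g t x).toReal) ∂lam := withDensityᵥ_apply (i1.sub i2) hA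
  rw [(ν t).apply_eq_posPart_real_sub_negPart_real hA, hwd,
    integral_sub i1.integrableOn i2.integrableOn, h1, h2]
  congr 1
  · rw [measureReal_def, withDensity_apply _ hA, integral_toReal mf.aemeasurable
      (ae_restrict_of_ae (ae_lt_top mf if1))]
  · rw [measureReal_def, withDensity_apply _ hA, integral_toReal mg.aemeasurable
      (ae_restrict_of_ae (ae_lt_top mg ig1))]

lemma aux_jordan {E : Type*} [MeasurableSpace E] (lam : Measure E) [IsFiniteMeasure lam]
    (s : SignedMeasure E) (f : E → ℝ) (hs : s = lam.withDensityᵥ f)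
    (hf : Measurable f) (hfi : Integrable f lam) :
    s.toJordanDecomposition.posPart =
        lam.withDensity (fun x => ENNReal.ofReal (f x)) ∧
    s.toJordanDecomposition.negPart =
        lam.withDensity (fun x => ENNReal.ofReal (- f x)) := by
  have h := SignedMeasure.toJordanDecomposition_eq_of_eq_add_withDensity (s := s)
    (t := 0) (μ := lam) hf hfi (VectorMeasure.MutuallySingular.zero_left) (by simp [hs])
  rw [h]
  simp [SignedMeasure.toJordanDecomposition_zero]

lemma aux_tv {E : Type*} [MeasurableSpace E] (lam : Measure E) [IsFiniteMeasure lam]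
    (s : SignedMeasure E) (f : E → ℝ) (hs : s = lam.withDensityᵥ f)
    (hf : Measurable f) (hfi : Integrable f lam) :
    s.totalVariation = lam.withDensity (fun x => ENNReal.ofReal |f x|) := by
  rw [SignedMeasure.totalVariation, (aux_jordan lam s f hs hf hfi).1, (aux_jordan lam s f hs hf hfi).2,
    ← withDensity_add_left hf.ennreal_ofReal]
  congr 1
  ext x
  simp only [Pi.add_apply]
  rcases le_total 0 (f x) with h | h
  · rw [abs_of_nonneg h, ENNReal.ofReal_of_nonpos (p := -f x) (by linarith), add_zero]
  · rw [abs_of_nonpos h, ENNReal.ofReal_of_nonpos h, zero_add]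

lemma aux_wd_integral {E : Type*} [MeasurableSpace E] (lam : Measure E)
    (f g : E → ℝ) (hf : Measurable f) (A : Set E) (hA : MeasurableSet A) :
    ∫ x in A, g x ∂(lam.withDensity (fun x => ENNReal.ofReal (f x))) =
      ∫ x in A, (max (f x) 0) * g x ∂lam := by
  have := setIntegral_withDensity_eq_setIntegral_toReal_smul (μ := lam)
    (f := fun x => ENNReal.ofReal (f x)) hf.ennreal_ofReal
    (ae_of_all _ fun x => ENNReal.ofReal_lt_top) g hA
  rw [this]
  simp [ENNReal.toReal_ofReal']

lemma aux_ssi {E : Type*} [MeasurableSpace E] (lam : Measure E) [IsFiniteMeasure lam]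
    (s : SignedMeasure E) (f : E → ℝ) (hs : s = lam.withDensityᵥ f)
    (hf : Measurable f) (hfi : Integrable f lam) (g : E → ℝ) (hg : Measurable g)
    (hg1 : ∀ x, |g x| ≤ 1) (A : Set E) (hA : MeasurableSet A) :
    signedSetIntegral g A s = ∫ x in A, g x * f x ∂lam := by
  rw [signedSetIntegral, (aux_jordan lam s f hs hf hfi).1, (aux_jordan lam s f hs hf hfi).2,
    aux_wd_integral lam f g hf A hA, aux_wd_integral lam (fun x => - f x) g hf.neg A hA,
    ← integral_sub]
  · congr 1
    ext x
    rcases le_total 0 (f x) with h | h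
    · rw [max_eq_left h, max_eq_right (by linarith)]; ring
    · rw [max_eq_right h, max_eq_left (by linarith)]; ring
  · exact (hfi.pos_part.integrableOn).mul_bdd (c := 1) hg.aestronglyMeasurable (ae_of_all _ hg1)
  · exact (hfi.neg_part.integrableOn).mul_bdd (c := 1) hg.aestronglyMeasurable (ae_of_all _ hg1)

lemma aux_chain (g : ℝ → ℝ) (c t : ℝ)
    (hg : IntervalIntegrable g volume 0 t) :
    |c + ∫ u in (0:ℝ)..t, g u| =
      |c| + ∫ s in (0:ℝ)..t, Real.sign (c + ∫ u in (0:ℝ)..s, g u) * g s := by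
  set F : ℝ → ℝ := fun s => c + ∫ u in (0:ℝ)..s, g u with hF
  have hac : AbsolutelyContinuousOnInterval F 0 t := by
    have h1 := hg.absolutelyContinuousOnInterval_intervalIntegral (c := 0) (by simp)
    have h2 : AbsolutelyContinuousOnInterval (fun _ : ℝ => c) 0 t :=
      (LipschitzOnWith.of_dist_le_mul (K := 0) (by simp)).absolutelyContinuousOnInterval
    exact h2.fun_add h1
  have habs : AbsolutelyContinuousOnInterval (fun s => |F s|) 0 t := by
    rw [absolutelyContinuousOnInterval_iff] at hac ⊢
    intro ε hε
    obtain ⟨δ, hδ, h⟩ := hac ε hε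
    refine ⟨δ, hδ, fun E hE hE' => lt_of_le_of_lt (Finset.sum_le_sum fun i _ => ?_) (h E hE hE')⟩
    rw [Real.dist_eq, Real.dist_eq]
    exact abs_abs_sub_abs_le _ _
  have key := habs.integral_deriv_eq_sub
  have hF0 : F 0 = c := by simp [hF]
  rw [hF0] at key
  have : ∫ s in (0:ℝ)..t, Real.sign (F s) * g s = ∫ s in (0:ℝ)..t, deriv (fun s => |F s|) s := by
    apply intervalIntegral.integral_congr_ae
    filter_upwards [hg.ae_hasDerivAt_integral, habs.ae_differentiableAt] with x h1 h2 hx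
    have hx' : x ∈ Set.uIcc 0 t := Set.uIoc_subset_uIcc hx
    have hd : HasDerivAt F (g x) x := (h1 hx' 0 (by simp)).const_add c
    rcases lt_trichotomy (F x) 0 with h | h | h
    · have h3 : HasDerivAt (fun s => |F s|) _ x := (hasDerivAt_abs_neg h).comp x hd
      rw [Real.sign_of_neg h, h3.deriv]
    · rw [h, Real.sign_zero, zero_mul]
      symm
      refine IsLocalMin.deriv_eq_zero (Filter.Eventually.of_forall fun y => ?_)
      simp [h]
    · have h3 : HasDerivAt (fun s => |F s|) _ x := (hasDerivAt_abs_pos h).comp x hd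
      rw [Real.sign_of_pos h, h3.deriv]
  change |F t| = |c| + ∫ s in (0:ℝ)..t, Real.sign (F s) * g s
  rw [this, key]; ring

lemma aux_sign_measurable : Measurable Real.sign := by
  unfold Real.sign
  exact Measurable.ite measurableSet_Iio measurable_const
    (Measurable.ite measurableSet_Ioi measurable_const measurable_const)

lemma aux_sign_abs_le (r : ℝ) : |Real.sign r| ≤ 1 := by
  rcases Real.sign_apply_eq r with h | h | h <;> rw [h] <;> simp

lemma aux_fubini {E : Type*} [MeasurableSpace E] (lam : Measure E) [IsFiniteMeasure lam]
    (h : ℝ → E → ℝ) (T t : ℝ) (ht : t ≤ T)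
    (hi : Integrable (Function.uncurry h) ((volume.restrict (Set.Ioc 0 T)).prod lam))
    (A : Set E) :
    IntegrableOn (fun x => ∫ s in Set.Ioc 0 t, h s x) A lam ∧
    ∫ x in A, (∫ s in Set.Ioc 0 t, h s x) ∂lam = ∫ s in Set.Ioc 0 t, ∫ x in A, h s x ∂lam := by
  have hi' : Integrable (Function.uncurry h)
      ((volume.restrict (Set.Ioc 0 t)).prod (lam.restrict A)) := by
    refine hi.mono_measure ?_
    exact Measure.prod_mono (Measure.restrict_mono (Set.Ioc_subset_Ioc_right ht) le_rfl)
      Measure.restrict_le_self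
  exact ⟨hi'.integral_prod_right, (integral_integral_swap hi').symm⟩

/-- Lemma A.1: evolution of the total variation of a time-integral of
time-dependent signed measures. -/
theorem signedMeasure_total_variation_evolution
    (E : Type) (mE : MeasurableSpace E) (hcg : MeasurableSpace.CountablyGenerated E)
    (T : ℝ) (hT : 0 < T)
    (lam0 : Measure E) (hlam0 : IsFiniteMeasure lam0)
    (μ : ℝ → SignedMeasure E) (ν : ℝ → SignedMeasure E)
    (hmeas : ∀ A : Set E, MeasurableSet A → Measurable fun t => ν t A)
    (hac : ∀ t ∈ Set.Icc (0:ℝ) T, ∀ A : Set E, MeasurableSet A →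
      lam0 A = 0 → ν t A = 0)
    (hint : (∫⁻ t in Set.Icc (0:ℝ) T, (ν t).totalVariation Set.univ) ≠ ⊤)
    (hevol : ∀ t ∈ Set.Icc (0:ℝ) T, ∀ A : Set E, MeasurableSet A →
      μ t A = μ 0 A + ∫ s in Set.Ioc (0:ℝ) t, ν s A) :
    ∃ σ : ℝ → E → ℝ, Measurable (Function.uncurry σ) ∧
      (∀ t x, σ t x = -1 ∨ σ t x = 0 ∨ σ t x = 1) ∧
      ∀ t ∈ Set.Icc (0:ℝ) T,
        (∀ A : Set E, MeasurableSet A →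
          μ t A = ∫ x in A, σ t x ∂(μ t).totalVariation) ∧
        (∀ A : Set E, MeasurableSet A →
          ((μ t).totalVariation A).toReal =
            ((μ 0).totalVariation A).toReal +
              ∫ s in Set.Ioc (0:ℝ) t, signedSetIntegral (σ s) A (ν s)) := by
  set lam : Measure E := lam0 + (μ 0).totalVariation with hlam
  have hle : lam0 ≪ lam := (Measure.le_add_right le_rfl).absolutelyContinuous
  have hle' : (μ 0).totalVariation ≪ lam := (Measure.le_add_left le_rfl).absolutelyContinuous
  have hνac : ∀ t ∈ Set.Icc (0:ℝ) T, (ν t).totalVariation ≪ lam := by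
    intro t ht
    have h := (SignedMeasure.absolutelyContinuous_ennreal_iff (ν t)
      lam0.toENNRealVectorMeasure).1 (VectorMeasure.AbsolutelyContinuous.mk fun A hA h0 => by
        rw [Measure.toENNRealVectorMeasure_apply_measurable hA] at h0
        exact hac t ht A hA h0)
    rw [VectorMeasure.ennrealToMeasure_toENNRealVectorMeasure] at h
    exact h.trans hle
  obtain ⟨n, hn, hn'⟩ := aux_signed_density ν hmeas lam
  obtain ⟨m0', hm0', hm0''⟩ := aux_signed_density (fun _ => μ 0) (fun _ _ => measurable_const) lam
  obtain ⟨hm0i, hm0⟩ := hm0'' 0 hle'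
  have hm0m : Measurable (m0' 0) := hm0'.of_uncurry_left
  generalize m0' 0 = m0 at hm0i hm0 hm0m
  clear hm0' hm0'' m0'
  have hnm : ∀ t, Measurable (n t) := fun t => hn.of_uncurry_left
  -- product integrability
  have hprod : Integrable (Function.uncurry n) ((volume.restrict (Set.Ioc 0 T)).prod lam) := by
    refine ⟨hn.aestronglyMeasurable, ?_⟩
    rw [hasFiniteIntegral_iff_enorm, lintegral_prod _ hn.enorm.aemeasurable]
    have h1 : ∫⁻ t in Set.Ioc 0 T, ∫⁻ x, ‖Function.uncurry n (t, x)‖ₑ ∂lam =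
        ∫⁻ t in Set.Ioc 0 T, (ν t).totalVariation Set.univ := by
      refine setLIntegral_congr_fun measurableSet_Ioc fun t ht => ?_
      obtain ⟨h2, h3⟩ := hn' t (hνac t (Set.Ioc_subset_Icc_self ht))
      simp only [Function.uncurry]
      rw [aux_tv lam (ν t) (n t) h3 (hnm t) h2, withDensity_apply _ MeasurableSet.univ,
        setLIntegral_univ]
      simp [Real.enorm_eq_ofReal_abs]
    rw [h1]
    exact lt_of_le_of_lt (lintegral_mono_set Set.Ioc_subset_Icc_self) hint.lt_top
  set m : ℝ → E → ℝ := fun t x => m0 x + ∫ s in Set.Ioc 0 t, n s x with hm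
  have hmm : Measurable (Function.uncurry m) := by
    have h1 : Measurable fun p : ℝ × E => ∫ s, (Set.Ioc 0 p.1).indicator (fun s => n s p.2) s := by
      refine StronglyMeasurable.measurable ?_
      refine StronglyMeasurable.integral_prod_right
        (f := fun (p : ℝ × E) (s : ℝ) => (Set.Ioc 0 p.1).indicator (fun s => n s p.2) s) ?_
      refine Measurable.stronglyMeasurable ?_
      have : (Function.uncurry fun (p : ℝ × E) (s : ℝ) =>
          (Set.Ioc 0 p.1).indicator (fun s => n s p.2) s) =
          {q : (ℝ × E) × ℝ | 0 < q.2 ∧ q.2 ≤ q.1.1}.indicator (fun q => n q.2 q.1.2) := by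
        ext ⟨p, s⟩
        simp [Function.uncurry, Set.indicator]
      rw [this]
      refine Measurable.indicator ?_ ?_
      · exact hn.comp (measurable_snd.prodMk (measurable_snd.comp measurable_fst))
      · exact (measurableSet_lt measurable_const measurable_snd).inter
          (measurableSet_le measurable_snd (measurable_fst.comp measurable_fst))
    have h2 : Function.uncurry m = fun p : ℝ × E => m0 p.2 +
        ∫ s, (Set.Ioc 0 p.1).indicator (fun s => n s p.2) s := by
      ext ⟨t, x⟩
      simp only [hm, Function.uncurry]
      rw [integral_indicator measurableSet_Ioc]
    rw [h2]
    exact (hm0m.comp measurable_snd).add h1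
  have hmt : ∀ t, Measurable (m t) := fun t => hmm.of_uncurry_left
  have hmi : ∀ t ∈ Set.Icc 0 T, Integrable (m t) lam := by
    intro t ht
    refine hm0i.add ?_
    have := (aux_fubini lam n T t ht.2 hprod Set.univ).1
    rwa [integrableOn_univ] at this
  have hμ : ∀ t ∈ Set.Icc 0 T, μ t = lam.withDensityᵥ (m t) := by
    intro t ht
    ext A hA
    have hf := aux_fubini lam n T t ht.2 hprod A
    rw [hevol t ht A hA, withDensityᵥ_apply (hmi t ht) hA, hm, integral_add hm0i.integrableOn hf.1,
      hf.2, hm0, withDensityᵥ_apply hm0i hA]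
    congr 1
    refine setIntegral_congr_fun measurableSet_Ioc fun s hs => ?_
    obtain ⟨h2, h3⟩ := hn' s (hνac s ⟨hs.1.le, hs.2.trans ht.2⟩)
    rw [h3, withDensityᵥ_apply h2 hA]
  have hσm : Measurable (Function.uncurry fun t x => Real.sign (m t x)) :=
    aux_sign_measurable.comp hmm
  have htvA : ∀ t ∈ Set.Icc 0 T, ∀ A, MeasurableSet A →
      ((μ t).totalVariation A).toReal = ∫ x in A, |m t x| ∂lam := by
    intro t ht A hA
    rw [aux_tv lam (μ t) (m t) (hμ t ht) (hmt t) (hmi t ht), withDensity_apply _ hA,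
      integral_eq_lintegral_of_nonneg_ae (ae_of_all _ fun x => abs_nonneg _)
        (hmt t).abs.aestronglyMeasurable]
  have hprod' : Integrable (Function.uncurry fun t x => Real.sign (m t x) * n t x)
      ((volume.restrict (Set.Ioc 0 T)).prod lam) :=
    hprod.bdd_mul (c := 1) hσm.aestronglyMeasurable (ae_of_all _ fun p => aux_sign_abs_le _)
  refine ⟨fun t x => Real.sign (m t x), hσm, fun t x => Real.sign_apply_eq _, ?_⟩
  intro t ht
  refine ⟨fun A hA => ?_, fun A hA => ?_⟩
  · rw [aux_tv lam (μ t) (m t) (hμ t ht) (hmt t) (hmi t ht),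
      aux_wd_integral lam (fun x => |m t x|) _ (hmt t).abs A hA]
    conv_lhs => rw [hμ t ht, withDensityᵥ_apply (hmi t ht) hA]
    congr 1
    ext x
    rw [max_eq_left (abs_nonneg _), mul_comm]
    change m t x = Real.sign (m t x) * |m t x|
    rcases lt_trichotomy (m t x) 0 with h | h | h
    · rw [Real.sign_of_neg h, abs_of_neg h]; ring
    · rw [h]; simp
    · rw [Real.sign_of_pos h, abs_of_pos h]; ring
  · rw [htvA t ht A hA, htvA 0 ⟨le_rfl, hT.le⟩ A hA]
    have hf := aux_fubini lam (fun t x => Real.sign (m t x) * n t x) T t ht.2 hprod' A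
    have h1 : ∫ s in Set.Ioc (0:ℝ) t, signedSetIntegral (fun x => Real.sign (m s x)) A (ν s) =
        ∫ s in Set.Ioc (0:ℝ) t, ∫ x in A, Real.sign (m s x) * n s x ∂lam := by
      refine setIntegral_congr_fun measurableSet_Ioc fun s hs => ?_
      obtain ⟨h2, h3⟩ := hn' s (hνac s ⟨hs.1.le, hs.2.trans ht.2⟩)
      exact aux_ssi lam (ν s) (n s) h3 (hnm s) h2 _ (aux_sign_measurable.comp (hmt s))
        (fun x => aux_sign_abs_le _) A hA
    rw [h1, ← hf.2, ← integral_add (hmi 0 ⟨le_rfl, hT.le⟩).abs.integrableOn hf.1]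
    refine integral_congr_ae (ae_restrict_of_ae ?_)
    filter_upwards [hprod.prod_left_ae] with x hx
    have hx' : IntervalIntegrable (fun s => n s x) volume 0 t := by
      rw [intervalIntegrable_iff_integrableOn_Ioc_of_le ht.1]
      exact IntegrableOn.mono_set (t := Set.Ioc 0 T) hx (Set.Ioc_subset_Ioc_right ht.2)
    have hc := aux_chain (fun s => n s x) (m0 x) t hx'
    rw [intervalIntegral.integral_of_le ht.1, intervalIntegral.integral_of_le ht.1] at hc
    have h0 : m 0 x = m0 x := by simp [hm]
    rw [h0]
    refine hc.trans ?_
    congr 1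
    refine setIntegral_congr_fun measurableSet_Ioc fun s hs => ?_
    rw [intervalIntegral.integral_of_le hs.1.le]
end
end

section
/- Let d ≥ 2 and let B be a collision kernel satisfying the standing assumptions (1.1). For every p ∈ (2,∞) there is a constant β = β(B,p) > 0 such that, for all v, v_* ∈ ℝ^d with v ≠ v_* and u = (v − v_*)/|v − v_*|, ∫_{S^{d−1}} { |v′|^p + |v′_*|^p − |v|^p − |v_*|^p } B(u, dσ) ≤ −β (|v|^p + |v_*|^p) + β^{−1} (|v| |v_*|^{p−1} + |v|^{p−1} |v_*|). -/
open MeasureTheory ProbabilityTheory Filter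
open scoped ENNReal NNReal RealInnerProductSpace

noncomputable section

abbrev Vd (d : ℕ) := EuclideanSpace ℝ (Fin d)

namespace KacModel

variable {d : ℕ}

/-- Post-collision velocity `v' = (v+v*)/2 + |v-v*|σ/2`. -/
def postV (v vs σ : Vd d) : Vd d := (2:ℝ)⁻¹ • (v + vs) + ((2:ℝ)⁻¹ * ‖v - vs‖) • σ

/-- Post-collision velocity `v'_* = (v+v*)/2 - |v-v*|σ/2`. -/
def postVs (v vs σ : Vd d) : Vd d := (2:ℝ)⁻¹ • (v + vs) - ((2:ℝ)⁻¹ * ‖v - vs‖) • σ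

/-- The unit sphere `S^{d-1}` regarded as a subset of `ℝ^d`. -/
def unitSphere (d : ℕ) : Set (Vd d) := {σ | ‖σ‖ = 1}

/-- Standing assumptions (1.1) on a collision kernel, regarded as a family of
measures on `ℝ^d` carried by the unit sphere. -/
structure IsCollisionKernel (B : Vd d → Measure (Vd d)) : Prop where
  measurable : ∀ s : Set (Vd d), MeasurableSet s → Measurable fun v => B v s
  prob : ∀ u : Vd d, ‖u‖ = 1 → IsProbabilityMeasure (B u)
  support : ∀ u : Vd d, ‖u‖ = 1 → B u ((unitSphere d \ {u, -u})ᶜ) = 0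
  scaling : ∀ (c : ℝ), 0 ≤ c → ∀ u : Vd d, ‖u‖ = 1 →
    B (c • u) = ENNReal.ofReal c • B u
  symm : ∀ (R : Vd d ≃ₗᵢ[ℝ] Vd d) (u : Vd d), ‖u‖ = 1 → B (R u) = (B u).map R

/-- Total variation distance between two finite measures (dual formulation). -/
def tvDist {E : Type*} [MeasurableSpace E] (μ ν : Measure E) : ℝ :=
  ⨆ f : {f : E → ℝ // Measurable f ∧ ∀ x, |f x| ≤ 1},
    ((∫ x, f.1 x ∂μ) - ∫ x, f.1 x ∂ν)

/-- The Lipschitz assumption (1.2). -/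
def IsLipschitzKernel (B : Vd d → Measure (Vd d)) (κ : ℝ) : Prop :=
  1 ≤ κ ∧ ∀ v v' : Vd d, tvDist (B v) (B v') ≤ κ * ‖v - v'‖

/-- The Boltzmann sphere 𝒮. -/
def boltzmannSphere (d : ℕ) : Set (Measure (Vd d)) :=
  {μ | IsProbabilityMeasure μ ∧ (∫ v, v ∂μ) = 0 ∧ (∫ v, ‖v‖ ^ 2 ∂μ) = 1}

/-- 𝒮_N : normalized empirical measures in the Boltzmann sphere. -/
def empiricalSphere (d N : ℕ) : Set (Measure (Vd d)) :=
  {μ | μ ∈ boltzmannSphere d ∧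
    ∃ x : Fin N → Vd d, μ = (N : ℝ≥0∞)⁻¹ • ∑ i, Measure.dirac (x i)}

/-- The class ℱ of test functions. -/
def testF (d : ℕ) : Set (Vd d → ℝ) :=
  {f | (∀ v, |f v / (1 + ‖v‖ ^ 2)| ≤ 1) ∧
    ∀ v v', |f v / (1 + ‖v‖ ^ 2) - f v' / (1 + ‖v'‖ ^ 2)| ≤ ‖v - v'‖}

/-- The weighted Wasserstein distance W. -/
def Wdist (μ ν : Measure (Vd d)) : ℝ :=
  ⨆ f : testF d, ((∫ v, (f : Vd d → ℝ) v ∂μ) - ∫ v, (f : Vd d → ℝ) v ∂ν)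

/-- The p-th moment `∫ |v|^p dμ`, as a lower integral. -/
def momentL (p : ℝ) (μ : Measure (Vd d)) : ℝ≥0∞ :=
  ∫⁻ v, (‖v‖₊ : ℝ≥0∞) ^ p ∂μ

/-- Total variation measure |μ - ν| of the difference of two finite measures. -/
def tvMeasure {E : Type*} [MeasurableSpace E] (μ ν : Measure E) : Measure E :=
  (μ - ν) + (ν - μ)

/-- The post-collision update `μ^{v,v_*,σ}` of an empirical measure. -/
def collUpdate (N : ℕ) (μ : Measure (Vd d)) (v vs σ : Vd d) : Measure (Vd d) :=
  μ + (N : ℝ≥0∞)⁻¹ • (Measure.dirac (postV v vs σ) + Measure.dirac (postVs v vs σ))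
    - (N : ℝ≥0∞)⁻¹ • (Measure.dirac v + Measure.dirac vs)

/-- The generator 𝒢 of the Kac process. -/
def kacGen (B : Vd d → Measure (Vd d)) (N : ℕ) (F : Measure (Vd d) → ℝ)
    (μ : Measure (Vd d)) : ℝ :=
  N * ∫ v, (∫ vs, (∫ σ, (F (collUpdate N μ v vs σ) - F μ) ∂(B (v - vs))) ∂μ) ∂μ

/-- A Kac process with collision kernel `B` and particle number `N`:
a càdlàg adapted 𝒮_N-valued process solving the martingale problem for 𝒢. -/
structure IsKacProcess {Ω : Type*} [m : MeasurableSpace Ω]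
    (B : Vd d → Measure (Vd d)) (N : ℕ) (P : Measure Ω)
    (𝓕 : Filtration ℝ m) (μp : ℝ → Ω → Measure (Vd d)) : Prop where
  mem : ∀ t ω, μp t ω ∈ empiricalSphere d N
  adapted : ∀ f ∈ testF d, Adapted 𝓕 fun t ω => ∫ v, f v ∂(μp t ω)
  rightCont : ∀ ω, ∀ f ∈ testF d, ∀ t : ℝ,
    ContinuousWithinAt (fun s => ∫ v, f v ∂(μp s ω)) (Set.Ici t) t
  leftLim : ∀ ω, ∀ f ∈ testF d, ∀ t : ℝ, 0 < t →
    ∃ L : ℝ, Tendsto (fun s => ∫ v, f v ∂(μp s ω)) (nhdsWithin t (Set.Iio t)) (nhds L)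
  martingale : ∀ G : Measure (Vd d) → ℝ, Measurable G → (∃ M : ℝ, ∀ ν, |G ν| ≤ M) →
    Martingale (fun t ω => G (μp t ω) - ∫ s in Set.Ioc (0:ℝ) t, kacGen B N G (μp s ω)) 𝓕 P

/-- `⟨f, Q(μ,ν)⟩`, the Boltzmann collision integral. -/
def QInt (B : Vd d → Measure (Vd d)) (f : Vd d → ℝ) (μ ν : Measure (Vd d)) : ℝ :=
  ∫ v, (∫ vs, (∫ σ, (f (postV v vs σ) + f (postVs v vs σ) - f v - f vs) ∂(B (v - vs))) ∂ν) ∂μ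

/-- Measure solution of the spatially homogeneous Boltzmann equation, started at time τ. -/
def IsBoltzmannSolutionFrom (B : Vd d → Measure (Vd d)) (τ : ℝ)
    (μt : ℝ → Measure (Vd d)) : Prop :=
  (∀ t, τ ≤ t → μt t ∈ boltzmannSphere d) ∧
  ∀ f : Vd d → ℝ, Measurable f → (∃ M, ∀ v, |f v| ≤ M) → HasCompactSupport f →
    ∀ t, τ ≤ t →
      (∫ v, f v ∂(μt t)) = (∫ v, f v ∂(μt τ)) + ∫ s in Set.Ioc τ t, QInt B f (μt s) (μt s)

/-- Measure solution of the spatially homogeneous Boltzmann equation (start time 0). -/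
def IsBoltzmannSolution (B : Vd d → Measure (Vd d)) (μt : ℝ → Measure (Vd d)) : Prop :=
  IsBoltzmannSolutionFrom B 0 μt

/-- Local boundedness in 𝒮(p) from time τ on. -/
def LocBddMomentFrom (p τ : ℝ) (μt : ℝ → Measure (Vd d)) : Prop :=
  ∀ T, τ ≤ T → ∃ M : ℝ≥0∞, M ≠ ⊤ ∧ ∀ t ∈ Set.Icc τ T, momentL p (μt t) ≤ M

/-- Sample mean. -/
def sampleMean {Ω : Type*} {N : ℕ} (Vs : Fin N → Ω → Vd d) (ω : Ω) : Vd d :=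
  (N : ℝ)⁻¹ • ∑ i, Vs i ω

/-- Sample mean square. -/
def sampleQ {Ω : Type*} {N : ℕ} (Vs : Fin N → Ω → Vd d) (ω : Ω) : ℝ :=
  (N : ℝ)⁻¹ * ∑ i, ‖Vs i ω‖ ^ 2

/-- Sample variance. -/
def sampleS {Ω : Type*} {N : ℕ} (Vs : Fin N → Ω → Vd d) (ω : Ω) : ℝ :=
  sampleQ Vs ω - ‖sampleMean Vs ω‖ ^ 2

/-- The rescaled empirical distribution μ̃^N. -/
def rescaledEmpirical {Ω : Type*} {N : ℕ} (Vs : Fin N → Ω → Vd d)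
    (μdef : Measure (Vd d)) (ω : Ω) : Measure (Vd d) :=
  if 0 < sampleS Vs ω then
    (N : ℝ≥0∞)⁻¹ • ∑ i, Measure.dirac
      ((Real.sqrt (sampleS Vs ω))⁻¹ • (Vs i ω - sampleMean Vs ω))
  else μdef

/-- The N-sample empirical distribution. -/
def empMeasure {Ω : Type*} {N : ℕ} (Vs : Fin N → Ω → Vd d) (ω : Ω) : Measure (Vd d) :=
  (N : ℝ≥0∞)⁻¹ • ∑ i, Measure.dirac (Vs i ω)

end KacModel

open KacModel

lemma pov_pw (q x y S M : ℝ) (hq : 1 < q) (hx : 0 ≤ x) (hy : 0 ≤ y) (hS : x + y ≤ S)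
    (hxM : x ≤ M) (hyM : y ≤ M) : x ^ q + y ^ q ≤ S * M ^ (q - 1) := by
  have key : ∀ z : ℝ, 0 ≤ z → z ≤ M → z ^ q ≤ z * M ^ (q - 1) := by
    intro z hz hzM
    have h1 : z ^ q = z * z ^ (q - 1) := by
      rw [← Real.rpow_one_add' hz (by linarith)]; congr 1; ring
    rw [h1]
    exact mul_le_mul_of_nonneg_left (Real.rpow_le_rpow hz hzM (by linarith)) hz
  have h0 : 0 ≤ M ^ (q - 1) := Real.rpow_nonneg (hx.trans hxM) _
  have := mul_le_mul_of_nonneg_right hS h0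
  linarith [key x hx hxM, key y hy hyM]

lemma pov_scale (p a s t : ℝ) (hp : 2 < p) (ha : 0 ≤ a) (ht : 0 ≤ t) :
    (s * a ^ 2) * (t * a ^ 2) ^ (p / 2 - 1) = a ^ p * (s * t ^ (p / 2 - 1)) := by
  have h1 : a ^ p = a ^ 2 * (a ^ 2) ^ (p / 2 - 1) := by
    rw [← Real.rpow_one_add' (by positivity) (by linarith), ← Real.rpow_natCast,
      ← Real.rpow_mul ha]
    congr 1; push_cast; ring
  rw [Real.mul_rpow ht (by positivity), h1]; ring

lemma pov_sq (p a : ℝ) (ha : 0 ≤ a) : a ^ p = (a ^ 2) ^ (p / 2) := by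
  rw [← Real.rpow_natCast, ← Real.rpow_mul ha]
  congr 1; push_cast; ring

lemma pov_sum {d : ℕ} (v vs σ : Vd d) (hσ : ‖σ‖ = 1) :
    ‖postV v vs σ‖ ^ 2 + ‖postVs v vs σ‖ ^ 2 = ‖v‖ ^ 2 + ‖vs‖ ^ 2 := by
  unfold postV postVs
  have h1 := parallelogram_law_with_norm ℝ ((2:ℝ)⁻¹ • (v + vs)) (((2:ℝ)⁻¹ * ‖v - vs‖) • σ)
  have h2 := parallelogram_law_with_norm ℝ v vs
  have h3 : ‖(2:ℝ)⁻¹ • (v + vs)‖ = 2⁻¹ * ‖v + vs‖ := by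
    rw [norm_smul]; norm_num
  have h4 : ‖((2:ℝ)⁻¹ * ‖v - vs‖) • σ‖ = 2⁻¹ * ‖v - vs‖ := by
    rw [norm_smul, hσ, Real.norm_of_nonneg (by positivity), mul_one]
  rw [h3, h4] at h1
  nlinarith

lemma pov_postVs {d : ℕ} (v vs σ : Vd d) : postVs v vs σ = postV v vs (-σ) := by
  unfold postV postVs
  rw [smul_neg, sub_eq_add_neg]

lemma pov_good {d : ℕ} (v vs σ : Vd d) (c : ℝ) (hc0 : 0 ≤ c) (hc1 : c ≤ 1) (hne : v ≠ vs)
    (hσ : ‖σ‖ = 1)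
    (hab : ‖vs‖ ≤ ‖v‖) (hg : ⟪σ, ‖v - vs‖⁻¹ • (v - vs)⟫ ≤ c) :
    ‖postV v vs σ‖ ^ 2 ≤ (‖v‖ ^ 2 + ‖vs‖ ^ 2) * ((1 + c) / 2) + 3 * (‖v‖ * ‖vs‖) := by
  have hr : 0 < ‖v - vs‖ := norm_pos_iff.2 (sub_ne_zero.2 hne)
  have h1 : ⟪σ, v - vs⟫ ≤ c * ‖v - vs‖ := by
    rw [real_inner_smul_right, inv_mul_le_iff₀ hr] at hg; linarith
  have h2 : ⟪σ, v + vs⟫ ≤ c * ‖v - vs‖ + 2 * ‖vs‖ := by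
    have : v + vs = (v - vs) + (2:ℝ) • vs := by rw [two_smul]; abel
    rw [this, inner_add_right, real_inner_smul_right]
    have := real_inner_le_norm σ vs
    rw [hσ] at this; linarith
  have h3 : ‖postV v vs σ‖ ^ 2 = (‖v‖ ^ 2 + ‖vs‖ ^ 2) / 2 + ‖v - vs‖ * ⟪σ, v + vs⟫ / 2 := by
    unfold postV
    rw [norm_add_sq_real, real_inner_smul_left, real_inner_smul_right, norm_smul, norm_smul, hσ,
      Real.norm_of_nonneg (by positivity : (0:ℝ) ≤ 2⁻¹ * ‖v - vs‖), real_inner_comm,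
      Real.norm_of_nonneg (by positivity : (0:ℝ) ≤ 2⁻¹)]
    have := parallelogram_law_with_norm ℝ v vs
    nlinarith
  have h4 := mul_le_mul_of_nonneg_left h2 hr.le
  have h5 : ‖v - vs‖ ≤ ‖v‖ + ‖vs‖ := norm_sub_le _ _
  have h6 : ‖v - vs‖ ^ 2 ≤ ‖v‖ ^ 2 + ‖vs‖ ^ 2 + 2 * (‖v‖ * ‖vs‖) := by
    nlinarith [norm_nonneg v, norm_nonneg vs]
  have h7 := mul_le_mul_of_nonneg_left h6 hc0
  have h8 := mul_le_mul_of_nonneg_right h5 (norm_nonneg vs)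
  have h9 := mul_le_mul_of_nonneg_right hab (norm_nonneg vs)
  have h10 : c * (‖v‖ * ‖vs‖) ≤ ‖v‖ * ‖vs‖ := by
    have : 0 ≤ ‖v‖ * ‖vs‖ := by positivity
    nlinarith
  rw [h3]
  nlinarith

/-- Integration of the two-level pointwise bound. -/
lemma pov_int {d : ℕ} (ν : Measure (Vd d)) [IsProbabilityMeasure ν] (hν : ∀ᵐ σ ∂ν, ‖σ‖ = 1)
    (p : ℝ) (hp : 2 < p) (v vs : Vd d) (G : Set (Vd d)) (hG : MeasurableSet G) (L1 L2 : ℝ)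
    (h1 : ∀ σ ∈ G, ‖σ‖ = 1 → ‖postV v vs σ‖ ^ p + ‖postVs v vs σ‖ ^ p ≤ L1)
    (h2 : ∀ σ, ‖σ‖ = 1 → ‖postV v vs σ‖ ^ p + ‖postVs v vs σ‖ ^ p ≤ L2) :
    (∫ σ, (‖postV v vs σ‖ ^ p + ‖postVs v vs σ‖ ^ p - ‖v‖ ^ p - ‖vs‖ ^ p) ∂ν) ≤
      L2 + ν.real G * (L1 - L2) - ‖v‖ ^ p - ‖vs‖ ^ p := by
  have hcont : Continuous fun σ : Vd d => ‖postV v vs σ‖ ^ p + ‖postVs v vs σ‖ ^ p := by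
    unfold postV postVs
    refine Continuous.add ?_ ?_
    · exact Continuous.rpow_const (by fun_prop) (fun _ => Or.inr (by linarith))
    · exact Continuous.rpow_const (by fun_prop) (fun _ => Or.inr (by linarith))
  have hint : Integrable (fun σ : Vd d => ‖postV v vs σ‖ ^ p + ‖postVs v vs σ‖ ^ p) ν := by
    refine Integrable.of_bound hcont.aestronglyMeasurable L2 ?_
    filter_upwards [hν] with σ hσ
    rw [Real.norm_of_nonneg (by positivity)]
    exact h2 σ hσ
  have e : (fun σ => ‖postV v vs σ‖ ^ p + ‖postVs v vs σ‖ ^ p - ‖v‖ ^ p - ‖vs‖ ^ p) =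
      fun σ => (‖postV v vs σ‖ ^ p + ‖postVs v vs σ‖ ^ p) - (‖v‖ ^ p + ‖vs‖ ^ p) := by
    funext σ; ring
  have hind : Integrable (G.indicator fun _ => L1 - L2) ν :=
    (integrable_const _).indicator hG
  have hle : (∫ σ, (‖postV v vs σ‖ ^ p + ‖postVs v vs σ‖ ^ p) ∂ν) ≤
      ∫ σ, (L2 + G.indicator (fun _ => L1 - L2) σ) ∂ν := by
    refine integral_mono_ae hint ((integrable_const _).add hind) ?_
    filter_upwards [hν] with σ hσ
    by_cases hs : σ ∈ G
    · simp only [Set.indicator_of_mem hs]; linarith [h1 σ hs hσ]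
    · simp only [Set.indicator_of_notMem hs]; linarith [h2 σ hσ]
  rw [integral_add (integrable_const _) hind, integral_indicator_const _ hG] at hle
  rw [e, integral_sub hint (integrable_const _)]
  simp at hle ⊢
  linarith

/-- The good set. -/
def povG {d : ℕ} (u : Vd d) (c : ℝ) : Set (Vd d) := {σ | |⟪σ, u⟫| ≤ c}

lemma povG_meas {d : ℕ} (u : Vd d) (c : ℝ) : MeasurableSet (povG u c) := by
  unfold povG
  exact (isClosed_le (by fun_prop) continuous_const).measurableSet

lemma pov_mass {d : ℕ} (hd : 2 ≤ d) (B : Vd d → Measure (Vd d)) (hB : IsCollisionKernel B) :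
    ∃ c m : ℝ, 0 ≤ c ∧ c < 1 ∧ 0 < m ∧ ∀ u, ‖u‖ = 1 → (B u).real (povG u c) = m := by
  obtain ⟨u0, hu0⟩ : ∃ u0 : Vd d, ‖u0‖ = 1 :=
    ⟨EuclideanSpace.single ⟨0, by omega⟩ 1, by simp⟩
  haveI := hB.prob u0 hu0
  obtain ⟨n, hn⟩ : ∃ n : ℕ, B u0 (povG u0 (1 - 1 / ((n:ℝ) + 1))) ≠ 0 := by
    by_contra! hcon
    have hU : B u0 (⋃ n : ℕ, povG u0 (1 - 1 / ((n:ℝ) + 1))) = 0 := measure_iUnion_null hcon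
    have huniv : (Set.univ : Set (Vd d)) ⊆
        (⋃ n : ℕ, povG u0 (1 - 1 / ((n:ℝ) + 1))) ∪ (unitSphere d \ {u0, -u0})ᶜ := by
      intro σ _
      by_cases hσ : σ ∈ unitSphere d \ {u0, -u0}
      · left
        obtain ⟨h1, h2⟩ := hσ
        have h1 : ‖σ‖ = 1 := h1
        simp only [Set.mem_insert_iff, Set.mem_singleton_iff, not_or] at h2
        have hlt : |⟪σ, u0⟫| < 1 := by
          rw [abs_lt]
          constructor
          · have := inner_lt_one_iff_real_of_norm_eq_one (x := σ) (y := -u0) h1 (by simpa using hu0)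
            have := this.2 h2.2
            rw [inner_neg_right] at this; linarith
          · exact (inner_lt_one_iff_real_of_norm_eq_one h1 hu0).2 h2.1
        obtain ⟨n, hn⟩ := exists_nat_one_div_lt (sub_pos.2 hlt)
        refine Set.mem_iUnion.2 ⟨n, ?_⟩
        change |⟪σ, u0⟫| ≤ _
        linarith
      · exact Or.inr hσ
    have : B u0 Set.univ = 0 := measure_mono_null huniv (measure_union_null hU (hB.support u0 hu0))
    simp at this
  set c : ℝ := 1 - 1 / ((n:ℝ) + 1) with hc
  refine ⟨c, (B u0).real (povG u0 c), ?_, ?_, ?_, ?_⟩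
  · have : 1 / ((n:ℝ) + 1) ≤ 1 := by
      rw [div_le_one (by positivity)]
      have : (0:ℝ) ≤ n := by positivity
      linarith
    linarith
  · have : 0 < 1 / ((n:ℝ) + 1) := by positivity
    linarith
  · exact ENNReal.toReal_pos hn (measure_ne_top _ _)
  · intro u hu
    let R : Vd d ≃ₗᵢ[ℝ] Vd d := (ℝ ∙ (u0 - u))ᗮ.reflection
    have hR : R u0 = u := Submodule.reflection_sub (by rw [hu0, hu])
    have h1 := hB.symm R u0 hu0
    rw [hR] at h1
    rw [h1, Measure.real, Measure.map_apply R.continuous.measurable (povG_meas _ _)]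
    congr 2
    ext σ
    change |⟪R σ, u⟫| ≤ c ↔ |⟪σ, u0⟫| ≤ c
    rw [← hR, R.inner_map_map]

lemma pov_half (p : ℝ) (hp : 2 < p) (c m : ℝ) (hc0 : 0 ≤ c) (hc1 : c < 1) (hm : 0 < m) :
    ∃ β : ℝ, 0 < β ∧ ∀ (d : ℕ) (ν : Measure (Vd d)) (v vs : Vd d), IsProbabilityMeasure ν →
      (∀ᵐ σ ∂ν, ‖σ‖ = 1) → v ≠ vs → ‖vs‖ ≤ ‖v‖ →
      ν.real (povG (‖v - vs‖⁻¹ • (v - vs)) c) = m →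
        (∫ σ, (‖postV v vs σ‖ ^ p + ‖postVs v vs σ‖ ^ p - ‖v‖ ^ p - ‖vs‖ ^ p) ∂ν) ≤
          -β * (‖v‖ ^ p + ‖vs‖ ^ p) +
            β⁻¹ * (‖v‖ * ‖vs‖ ^ (p - 1) + ‖v‖ ^ (p - 1) * ‖vs‖) := by
  let K1 : ℝ → ℝ := fun ε => (1 + ε ^ 2) * ((1 + ε ^ 2) * ((1 + c) / 2) + 3 * ε) ^ (p / 2 - 1)
  let K2 : ℝ → ℝ := fun ε => (1 + ε ^ 2) * (1 + ε ^ 2) ^ (p / 2 - 1)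
  let h : ℝ → ℝ := fun ε => K2 ε + m * (K1 ε - K2 ε) - 1
  have hK1 : Continuous K1 :=
    Continuous.mul (by fun_prop) (Continuous.rpow_const (by fun_prop) fun _ => Or.inr (by linarith))
  have hK2 : Continuous K2 :=
    Continuous.mul (by fun_prop) (Continuous.rpow_const (by fun_prop) fun _ => Or.inr (by linarith))
  have hh : Continuous h := by fun_prop
  have h0 : h 0 < 0 := by
    have : ((1 + c) / 2) ^ (p / 2 - 1) < 1 :=
      Real.rpow_lt_one (by linarith) (by linarith) (by linarith)
    simp only [h, K1, K2]
    norm_num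
    nlinarith
  obtain ⟨ε, hε0, hε1, hhε⟩ : ∃ ε : ℝ, 0 < ε ∧ ε ≤ 1 ∧ h ε < 0 := by
    have hev : ∀ᶠ x in nhds (0:ℝ), h x < 0 := hh.continuousAt.eventually_lt_const h0
    obtain ⟨r, hr, hball⟩ := Metric.eventually_nhds_iff.1 hev
    refine ⟨min (r / 2) 1, by positivity, min_le_right _ _, hball ?_⟩
    rw [Real.dist_eq, sub_zero, abs_of_pos (by positivity)]
    have := min_le_left (r / 2) 1
    linarith
  let C : ℝ := 2 * 2 ^ (p / 2 - 1)
  have hC : 0 < C := by positivity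
  let β : ℝ := min (-(h ε) / 2) (min 1 (ε / (C + 2)))
  have hβ : 0 < β := by
    refine lt_min (by linarith) (lt_min one_pos (by positivity))
  have hβ1 : β ≤ -(h ε) / 2 := min_le_left _ _
  have hβ2 : β ≤ 1 := (min_le_right _ _).trans (min_le_left _ _)
  have hβ3 : β ≤ ε / (C + 2) := (min_le_right _ _).trans (min_le_right _ _)
  clear_value β
  refine ⟨β, hβ, ?_⟩
  intro d ν v vs hprob hν hne hab hm'
  have ha := norm_nonneg v
  have hb := norm_nonneg vs
  have hap : 0 ≤ ‖v‖ ^ p := Real.rpow_nonneg ha _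
  have hbp : 0 ≤ ‖vs‖ ^ p := Real.rpow_nonneg hb _
  have habp : ‖vs‖ ^ p ≤ ‖v‖ ^ p := Real.rpow_le_rpow hb hab (by linarith)
  have hcross : 0 ≤ ‖v‖ * ‖vs‖ ^ (p - 1) := by positivity
  have hcross2 : 0 ≤ ‖v‖ ^ (p - 1) * ‖vs‖ := by positivity
  have hβi : 0 < β⁻¹ := inv_pos.2 hβ
  -- generic bound
  have gen : ∀ s t : ℝ, 0 ≤ t → ∀ σ : Vd d, ‖σ‖ = 1 → ‖v‖ ^ 2 + ‖vs‖ ^ 2 ≤ s * ‖v‖ ^ 2 →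
      ‖postV v vs σ‖ ^ 2 ≤ t * ‖v‖ ^ 2 → ‖postVs v vs σ‖ ^ 2 ≤ t * ‖v‖ ^ 2 →
      ‖postV v vs σ‖ ^ p + ‖postVs v vs σ‖ ^ p ≤ ‖v‖ ^ p * (s * t ^ (p / 2 - 1)) := by
    intro s t ht σ hσ hs hx hy
    rw [← pov_scale p ‖v‖ s t hp ha ht, pov_sq p _ (norm_nonneg (postV v vs σ)),
      pov_sq p _ (norm_nonneg (postVs v vs σ))]
    exact pov_pw _ _ _ _ _ (by linarith) (by positivity) (by positivity)
      ((pov_sum v vs σ hσ).le.trans hs) hx hy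
  have gen2 : ∀ s : ℝ, 0 ≤ s → ‖v‖ ^ 2 + ‖vs‖ ^ 2 ≤ s * ‖v‖ ^ 2 → ∀ σ : Vd d, ‖σ‖ = 1 →
      ‖postV v vs σ‖ ^ p + ‖postVs v vs σ‖ ^ p ≤ ‖v‖ ^ p * (s * s ^ (p / 2 - 1)) := by
    intro s hs0 hs σ hσ
    have := pov_sum v vs σ hσ
    exact gen s s hs0 σ hσ hs (by nlinarith [sq_nonneg ‖postVs v vs σ‖])
      (by nlinarith [sq_nonneg ‖postV v vs σ‖])
  rcases le_total ‖vs‖ (ε * ‖v‖) with hcase | hcase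
  · have hE : ‖v‖ ^ 2 + ‖vs‖ ^ 2 ≤ (1 + ε ^ 2) * ‖v‖ ^ 2 := by nlinarith
    have hI := pov_int ν hν p hp v vs (povG (‖v - vs‖⁻¹ • (v - vs)) c) (povG_meas _ _)
      (‖v‖ ^ p * K1 ε) (‖v‖ ^ p * K2 ε) ?_ (gen2 _ (by positivity) hE)
    · rw [hm'] at hI
      have e1 : ‖v‖ ^ p * K2 ε + m * (‖v‖ ^ p * K1 ε - ‖v‖ ^ p * K2 ε) - ‖v‖ ^ p
          = ‖v‖ ^ p * h ε := by simp only [h]; ring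
      have e2 : ‖v‖ ^ p * h ε ≤ ‖v‖ ^ p * (-2 * β) :=
        mul_le_mul_of_nonneg_left (by linarith) hap
      have e3 : 0 ≤ β⁻¹ * (‖v‖ * ‖vs‖ ^ (p - 1) + ‖v‖ ^ (p - 1) * ‖vs‖) := by positivity
      have e4 : β * ‖vs‖ ^ p ≤ β * ‖v‖ ^ p := mul_le_mul_of_nonneg_left habp hβ.le
      linarith
    · intro σ hσG hσ
      have hg : |⟪σ, ‖v - vs‖⁻¹ • (v - vs)⟫| ≤ c := hσG
      obtain ⟨hg1, hg2⟩ := abs_le.1 hg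
      have hM : (‖v‖ ^ 2 + ‖vs‖ ^ 2) * ((1 + c) / 2) + 3 * (‖v‖ * ‖vs‖) ≤
          ((1 + ε ^ 2) * ((1 + c) / 2) + 3 * ε) * ‖v‖ ^ 2 := by
        have := mul_le_mul_of_nonneg_right hE (by linarith : 0 ≤ (1 + c) / 2)
        have := mul_le_mul_of_nonneg_left hcase ha
        linarith
      refine gen _ _ (by positivity) σ hσ hE
        ((pov_good v vs σ c hc0 hc1.le hne hσ hab hg2).trans hM) ?_
      rw [pov_postVs]
      refine (pov_good v vs (-σ) c hc0 hc1.le hne (by simpa using hσ) hab ?_).trans hM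
      rw [inner_neg_left]; linarith
  · have hE : ‖v‖ ^ 2 + ‖vs‖ ^ 2 ≤ 2 * ‖v‖ ^ 2 := by nlinarith
    have g := gen2 2 (by norm_num) hE
    have hI := pov_int ν hν p hp v vs ∅ MeasurableSet.empty
      (‖v‖ ^ p * C) (‖v‖ ^ p * C) (fun σ hσ => absurd hσ (Set.notMem_empty σ)) g
    have e1 : ε * ‖v‖ ^ p ≤ ‖v‖ ^ (p - 1) * ‖vs‖ := by
      have : ‖v‖ ^ p = ‖v‖ ^ (p - 1) * ‖v‖ := by
        rw [← Real.rpow_add_one' ha (by linarith)]; congr 1; ring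
      rw [this]
      have := mul_le_mul_of_nonneg_left hcase (Real.rpow_nonneg ha (p - 1))
      linarith
    have e2 : C + 2 ≤ β⁻¹ * ε := by
      rw [le_div_iff₀ (by positivity)] at hβ3
      rw [le_inv_mul_iff₀ hβ]; exact hβ3
    have e3 : (C + 2) * ‖v‖ ^ p ≤ β⁻¹ * (‖v‖ ^ (p - 1) * ‖vs‖) := by
      calc (C + 2) * ‖v‖ ^ p ≤ β⁻¹ * ε * ‖v‖ ^ p := mul_le_mul_of_nonneg_right e2 hap
        _ = β⁻¹ * (ε * ‖v‖ ^ p) := by ring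
        _ ≤ _ := mul_le_mul_of_nonneg_left e1 hβi.le
    have e4 : 0 ≤ β⁻¹ * (‖v‖ * ‖vs‖ ^ (p - 1)) := by positivity
    have e5 : β * (‖v‖ ^ p + ‖vs‖ ^ p) ≤ 1 * (‖v‖ ^ p + ‖vs‖ ^ p) :=
      mul_le_mul_of_nonneg_right hβ2 (by positivity)
    simp only [sub_self, mul_zero, add_zero] at hI
    linarith

/-- The Povzner inequality (3.1). -/
theorem povzner_inequality
    (d : ℕ) (hd : 2 ≤ d) (B : Vd d → Measure (Vd d)) (hB : IsCollisionKernel B)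
    (p : ℝ) (hp : 2 < p) :
    ∃ β : ℝ, 0 < β ∧
      ∀ v vs : Vd d, v ≠ vs →
        (∫ σ, (‖postV v vs σ‖ ^ p + ‖postVs v vs σ‖ ^ p - ‖v‖ ^ p - ‖vs‖ ^ p)
            ∂(B (‖v - vs‖⁻¹ • (v - vs)))) ≤
          -β * (‖v‖ ^ p + ‖vs‖ ^ p) +
            β⁻¹ * (‖v‖ * ‖vs‖ ^ (p - 1) + ‖v‖ ^ (p - 1) * ‖vs‖) := by
  obtain ⟨c, m, hc0, hc1, hm, hmass⟩ := pov_mass hd B hB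
  obtain ⟨β, hβ, H⟩ := pov_half p hp c m hc0 hc1 hm
  refine ⟨β, hβ, ?_⟩
  intro v vs hne
  have hr : 0 < ‖v - vs‖ := norm_pos_iff.2 (sub_ne_zero.2 hne)
  have hu : ‖‖v - vs‖⁻¹ • (v - vs)‖ = 1 := by
    rw [norm_smul, norm_inv, norm_norm, inv_mul_cancel₀ hr.ne']
  have hν : ∀ᵐ σ ∂(B (‖v - vs‖⁻¹ • (v - vs))), ‖σ‖ = 1 := by
    refine measure_mono_null ?_ (hB.support _ hu)
    intro σ hσ hσ'
    exact hσ hσ'.1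
  rcases le_total ‖vs‖ ‖v‖ with hab | hab
  · exact H d _ v vs (hB.prob _ hu) hν hne hab (hmass _ hu)
  · have key := H d (B (‖v - vs‖⁻¹ • (v - vs))) vs v (hB.prob _ hu) hν hne.symm hab ?_
    · have e1 : ∀ σ, postV vs v σ = postV v vs σ := fun σ => by
        unfold postV; rw [add_comm vs v, norm_sub_rev vs v]
      have e2 : ∀ σ, postVs vs v σ = postVs v vs σ := fun σ => by
        unfold postVs; rw [add_comm vs v, norm_sub_rev vs v]
      have e3 : (fun σ => ‖postV v vs σ‖ ^ p + ‖postVs v vs σ‖ ^ p - ‖v‖ ^ p - ‖vs‖ ^ p) =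
          fun σ => ‖postV vs v σ‖ ^ p + ‖postVs vs v σ‖ ^ p - ‖vs‖ ^ p - ‖v‖ ^ p := by
        funext σ; rw [e1, e2]; ring
      rw [e3]
      refine key.trans (le_of_eq ?_)
      ring
    · rw [← hmass _ hu]
      congr 1
      ext σ
      unfold povG
      rw [Set.mem_setOf_eq, Set.mem_setOf_eq, norm_sub_rev vs v, ← neg_sub v vs, smul_neg,
        inner_neg_right, abs_neg]
end
end
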